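/- Let n ≥ 1 and let A ∈ ℝ≥0^{n×n} be a circulant matrix. Then Attr(A) = {x ∈ ℝ≥0^n : λ(A)·(A^{n²}⊗x) = A^{n²+1}⊗x}. -/

import Mathlib

open scoped NNReal Classical

namespace MaxAlg

variable {n : ℕ}

/-- cyclic successor on `Fin k` -/
def cyc {k : ℕ} (l : Fin k) : Fin k := ⟨(l.val + 1) % k, Nat.mod_lt _ l.pos⟩

/-- max-algebraic matrix product -/
noncomputable def mmul (A B : Matrix (Fin n) (Fin n) ℝ≥0) : Matrix (Fin n) (Fin n) ℝ≥0 :=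
  fun i k => Finset.univ.sup fun j => A i j * B j k

/-- max-algebraic identity matrix -/
def mId (n : ℕ) : Matrix (Fin n) (Fin n) ℝ≥0 := fun i j => if i = j then 1 else 0

/-- max-algebraic matrix power -/
noncomputable def mpow (A : Matrix (Fin n) (Fin n) ℝ≥0) : ℕ → Matrix (Fin n) (Fin n) ℝ≥0
  | 0 => mId n
  | t + 1 => mmul (mpow A t) A

/-- max-algebraic matrix-vector product -/
noncomputable def mvec (A : Matrix (Fin n) (Fin n) ℝ≥0) (x : Fin n → ℝ≥0) : Fin n → ℝ≥0 :=
  fun i => Finset.univ.sup fun j => A i j * x j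

/-- geometric mean of the cycle `c` of length `k` -/
noncomputable def cycMean (A : Matrix (Fin n) (Fin n) ℝ≥0) (k : ℕ) (c : Fin k → Fin n) : ℝ≥0 :=
  (∏ l : Fin k, A (c l) (c (cyc l))) ^ ((1 : ℝ) / (k : ℝ))

/-- maximum cycle geometric mean λ(A) -/
noncomputable def lam (A : Matrix (Fin n) (Fin n) ℝ≥0) : ℝ≥0 :=
  (Finset.Icc 1 n).sup fun k => Finset.univ.sup fun c : Fin k → Fin n => cycMean A k c

/-- attraction cone Attr(A) -/
def Attr (A : Matrix (Fin n) (Fin n) ℝ≥0) : Set (Fin n → ℝ≥0) :=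
  {x | ∃ s : ℕ, mvec (mpow A (s + 1)) x = fun i => lam A * mvec (mpow A s) x i}

/-- circulant matrix built from the vector of values `a_0, …, a_{n-1}` -/
def circ (a : Fin n → ℝ≥0) : Matrix (Fin n) (Fin n) ℝ≥0 := fun i j => a (j - i)

/-- A is a circulant matrix -/
def IsCirculant (A : Matrix (Fin n) (Fin n) ℝ≥0) : Prop := ∃ a : Fin n → ℝ≥0, A = circ a

/-- (i,j) is a critical edge of A -/
def IsCritEdge (A : Matrix (Fin n) (Fin n) ℝ≥0) (i j : Fin n) : Prop :=
  A i j ≠ 0 ∧ ∃ (k : ℕ) (c : Fin k → Fin n), 1 ≤ k ∧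
    (∀ l, A (c l) (c (cyc l)) ≠ 0) ∧
    cycMean A k c = lam A ∧ ∃ l, c l = i ∧ c (cyc l) = j

/-- there is a walk of length ≥ 1 from i to j in crit(A) -/
def CritWalk (A : Matrix (Fin n) (Fin n) ℝ≥0) (i j : Fin n) : Prop :=
  ∃ l : ℕ, 1 ≤ l ∧ ∃ w : ℕ → Fin n, w 0 = i ∧ w l = j ∧
    ∀ r < l, IsCritEdge A (w r) (w (r + 1))

/-- node i lies on a critical cycle of A -/
def OnCritCycle (A : Matrix (Fin n) (Fin n) ℝ≥0) (i : Fin n) : Prop :=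
  ∃ (k : ℕ) (c : Fin k → Fin n), 1 ≤ k ∧
    (∀ l, A (c l) (c (cyc l)) ≠ 0) ∧
    cycMean A k c = lam A ∧ ∃ l, c l = i

/-- family of one-dimensional intervals with bounds `lo`, `hi`,
each of one of the four forms -/
def IsIntervalFam (S : Fin n → Set ℝ≥0) (lo hi : Fin n → ℝ≥0) : Prop :=
  ∀ i, (S i).Nonempty ∧
    (S i = Set.Icc (lo i) (hi i) ∨ S i = Set.Ico (lo i) (hi i) ∨
     S i = Set.Ioc (lo i) (hi i) ∨ S i = Set.Ioo (lo i) (hi i))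

/-- the interval 𝐗 ⊆ ℝ≥0ⁿ determined by the family S -/
def box (S : Fin n → Set ℝ≥0) : Set (Fin n → ℝ≥0) := {x | ∀ i, x i ∈ S i}

/-- vertex x^{(k)}: x̄ in coordinate k and x̲ elsewhere -/
def vtx (lo hi : Fin n → ℝ≥0) (k : Fin n) : Fin n → ℝ≥0 :=
  Function.update lo k (hi k)

/-- the interval circulant matrix C(𝐚) determined by the interval family Sa -/
def Cset (Sa : Fin n → Set ℝ≥0) : Set (Matrix (Fin n) (Fin n) ℝ≥0) :=
  {A | ∃ a : Fin n → ℝ≥0, (∀ k, a k ∈ Sa k) ∧ A = circ a}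

/-- the matrix Â, with â_k = min(a̲, ā_k) where a̲ = max_k a̲_k -/
noncomputable def Ahat (alo ahi : Fin n → ℝ≥0) : Matrix (Fin n) (Fin n) ℝ≥0 :=
  circ fun k => min (Finset.univ.sup alo) (ahi k)

/-- the matrix A^{(k)} = Circulant(a̲_0,…,a̲_{k−1}, ā_k, a̲_{k+1},…,a̲_{n−1}) -/
def Ak (alo ahi : Fin n → ℝ≥0) (k : Fin n) : Matrix (Fin n) (Fin n) ℝ≥0 :=
  circ (Function.update alo k (ahi k))

end MaxAlg

namespace MaxAlg

lemma mvec_mmul {n : ℕ} (A B : Matrix (Fin n) (Fin n) ℝ≥0) (x : Fin n → ℝ≥0) :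
    mvec (mmul A B) x = mvec A (mvec B x) := by
  funext i
  simp only [mvec, mmul, NNReal.mul_finset_sup, NNReal.finset_sup_mul]
  rw [Finset.sup_comm]
  simp only [mul_assoc]

lemma mvec_mId {n : ℕ} (x : Fin n → ℝ≥0) : mvec (mId n) x = x := by
  funext i
  apply le_antisymm
  · refine Finset.sup_le fun j _ => ?_
    by_cases h : i = j <;> simp [mId, h]
  · exact le_trans (by simp [mId]) (Finset.le_sup (f := fun j => mId n i j * x j)
      (Finset.mem_univ i))

lemma mvec_mpow {n : ℕ} (A : Matrix (Fin n) (Fin n) ℝ≥0) (t : ℕ) (x : Fin n → ℝ≥0) :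
    mvec (mpow A t) x = (mvec A)^[t] x := by
  induction t generalizing x with
  | zero => exact mvec_mId x
  | succ t ih => rw [mpow, mvec_mmul, ih, Function.iterate_succ_apply]

lemma mvec_smul {n : ℕ} (A : Matrix (Fin n) (Fin n) ℝ≥0) (c : ℝ≥0) (x : Fin n → ℝ≥0) :
    mvec A (c • x) = c • mvec A x := by
  funext i
  simp only [mvec, Pi.smul_apply, smul_eq_mul, NNReal.mul_finset_sup]
  simp only [mul_left_comm]

lemma smul_mvec {n : ℕ} (A : Matrix (Fin n) (Fin n) ℝ≥0) (c : ℝ≥0) (x : Fin n → ℝ≥0) :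
    mvec (c • A) x = c • mvec A x := by
  funext i
  simp only [mvec, Matrix.smul_apply, Pi.smul_apply, smul_eq_mul, NNReal.mul_finset_sup, mul_assoc]

lemma iterate_mvec_eq_pow_smul {n : ℕ} {A : Matrix (Fin n) (Fin n) ℝ≥0} {c : ℝ≥0}
    {y : Fin n → ℝ≥0} (h : mvec A y = c • y) (t : ℕ) : (mvec A)^[t] y = c ^ t • y := by
  induction t with
  | zero => simp
  | succ t ih => rw [Function.iterate_succ_apply', ih, mvec_smul, h, smul_smul, pow_succ]

lemma mpow_circ_ge {n : ℕ} [NeZero n] (a : Fin n → ℝ≥0) (i : Fin n) (s : Multiset (Fin n)) :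
    (s.map a).prod ≤ mpow (circ a) s.card i (i + s.sum) := by
  induction s using Multiset.induction_on with
  | empty => simp [mpow, mId]
  | cons d s ih =>
    rw [Multiset.card_cons, mpow, mmul, Multiset.map_cons, Multiset.prod_cons, Multiset.sum_cons]
    refine le_trans ?_ (Finset.le_sup (Finset.mem_univ (i + s.sum)))
    have h : i + (d + s.sum) - (i + s.sum) = d := by abel
    rw [circ, h, mul_comm]
    exact mul_le_mul_left ih _

lemma exists_multiset_of_mpow_circ_ne_zero {n : ℕ} [NeZero n] (a : Fin n → ℝ≥0) (i : Fin n)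
    (t : ℕ) (j : Fin n) (h : mpow (circ a) t i j ≠ 0) :
    ∃ s : Multiset (Fin n), s.card = t ∧ i + s.sum = j ∧
      mpow (circ a) t i j = (s.map a).prod := by
  induction t generalizing j with
  | zero =>
    by_cases hij : i = j
    · exact ⟨0, by simp [mpow, mId, hij]⟩
    · simp [mpow, mId, hij] at h
  | succ t ih =>
    obtain ⟨k, -, hk⟩ := Finset.exists_mem_eq_sup Finset.univ Finset.univ_nonempty
      fun k => mpow (circ a) t i k * circ a k j
    have hk' : mpow (circ a) (t + 1) i j = mpow (circ a) t i k * circ a k j := hk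
    obtain ⟨s, hs, hsum, hp⟩ := ih k (left_ne_zero_of_mul (hk' ▸ h))
    refine ⟨(j - k) ::ₘ s, by simp [hs], ?_, ?_⟩
    · rw [Multiset.sum_cons, ← hsum]; abel
    · rw [hk', hp, Multiset.map_cons, Multiset.prod_cons, mul_comm]; rfl

lemma exists_zero_sum_submultiset {n : ℕ} [NeZero n] (s : Multiset (Fin n))
    (hs : 2 * n - 1 ≤ s.card) : ∃ t ≤ s, t.card = n ∧ t.sum = 0 := by
  cases n with
  | zero => exact (NeZero.ne 0 rfl).elim
  | succ m => exact ZMod.erdos_ginzburg_ziv_multiset (n := m + 1) s hs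

/-- The powers of a circulant matrix are periodic from exponent `n - 1` on, up to the factor
given by the largest entry. -/
lemma mpow_circ_add {n : ℕ} [NeZero n] (a : Fin n → ℝ≥0) {c : Fin n} (hc : ∀ k, a k ≤ a c)
    {t : ℕ} (ht : n - 1 ≤ t) : mpow (circ a) (t + n) = a c ^ n • mpow (circ a) t := by
  ext1 i j
  rw [Matrix.smul_apply, smul_eq_mul]
  apply le_antisymm
  · by_cases h : mpow (circ a) (t + n) i j = 0
    · simp [h]
    obtain ⟨s, hs, rfl, hp⟩ := exists_multiset_of_mpow_circ_ne_zero a i _ j h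
    obtain ⟨u, hu, hcard, hsum⟩ := exists_zero_sum_submultiset s (by omega)
    obtain ⟨v, rfl⟩ := Multiset.le_iff_exists_add.mp hu
    have hv : v.card = t := by rw [Multiset.card_add] at hs; omega
    rw [hp, Multiset.map_add, Multiset.prod_add, Multiset.sum_add, hsum, zero_add, ← hv]
    refine mul_le_mul' ?_ (mpow_circ_ge a i v)
    have := Multiset.prod_le_pow_card (u.map a) (a c) (by simpa using fun k _ => hc k)
    rwa [Multiset.card_map, hcard] at this
  · by_cases h : mpow (circ a) t i j = 0
    · simp [h]
    obtain ⟨s, hs, rfl, hp⟩ := exists_multiset_of_mpow_circ_ne_zero a i _ j h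
    have := mpow_circ_ge a i (Multiset.replicate n c + s)
    have hn : n • c = 0 := by simpa using card_nsmul_eq_zero' (x := c)
    rw [Multiset.map_add, Multiset.prod_add, Multiset.sum_add, Multiset.card_add,
      Multiset.sum_replicate, hn, zero_add, Multiset.card_replicate, hs, Multiset.map_replicate,
      Multiset.prod_replicate, ← hp, add_comm n t] at this
    exact this

lemma lam_circ {n : ℕ} [NeZero n] (a : Fin n → ℝ≥0) {c : Fin n} (hc : ∀ k, a k ≤ a c) :
    lam (circ a) = a c := by
  apply le_antisymm
  · refine Finset.sup_le fun k hk => Finset.sup_le fun w _ => ?_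
    have hk0 : k ≠ 0 := by have := (Finset.mem_Icc.mp hk).1; omega
    have h : ∏ l : Fin k, circ a (w l) (w (cyc l)) ≤ a c ^ k := by
      simpa using Finset.prod_le_pow_card Finset.univ (fun l : Fin k => circ a (w l) (w (cyc l)))
        (a c) fun l _ => hc _
    calc cycMean (circ a) k w ≤ (a c ^ k) ^ ((1 : ℝ) / k) := NNReal.rpow_le_rpow h (by positivity)
      _ = a c := by rw [one_div, NNReal.pow_rpow_inv_natCast _ hk0]
  · have hn : n ≠ 0 := NeZero.ne n
    have hnc : n • c = 0 := by simpa using card_nsmul_eq_zero' (x := c)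
    have hstep (l : Fin n) : circ a (l.val • c) ((cyc l).val • c) = a c := by
      have h : (cyc l).val • c = (l.val + 1) • c := by
        conv_rhs => rw [← Nat.mod_add_div (l.val + 1) n, add_nsmul, mul_nsmul, hnc]
        simp [cyc]
      rw [circ, h, succ_nsmul, add_sub_cancel_left]
    have hmean : cycMean (circ a) n (fun l => l.val • c) = a c := by
      simp only [cycMean, hstep, Finset.prod_const, Finset.card_univ, Fintype.card_fin, one_div]
      exact NNReal.pow_rpow_inv_natCast _ hn
    calc a c = cycMean (circ a) n (fun l => l.val • c) := hmean.symm
      _ ≤ Finset.univ.sup fun w : Fin n → Fin n => cycMean (circ a) n w :=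
        Finset.le_sup (Finset.mem_univ _)
      _ ≤ lam (circ a) := Finset.le_sup
        (f := fun k => Finset.univ.sup fun w : Fin k → Fin n => cycMean (circ a) k w)
        (Finset.mem_Icc.mpr ⟨Nat.one_le_iff_ne_zero.mpr hn, le_rfl⟩)

lemma iterate_mvec_circ_add_mul {n : ℕ} [NeZero n] (a : Fin n → ℝ≥0) {c : Fin n}
    (hc : ∀ k, a k ≤ a c) {t : ℕ} (ht : n - 1 ≤ t) (x : Fin n → ℝ≥0) (m : ℕ) :
    (mvec (circ a))^[t + n * m] x = a c ^ (n * m) • (mvec (circ a))^[t] x := by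
  induction m with
  | zero => simp
  | succ m ih =>
    rw [Nat.mul_succ, ← add_assoc, ← mvec_mpow, mpow_circ_add a hc (by omega), smul_mvec,
      mvec_mpow, ih, smul_smul, ← pow_add, add_comm n]

end MaxAlg

open MaxAlg in
/-- for a circulant matrix `A`,
`Attr(A) = {x : λ(A)·(A^{n²}⊗x) = A^{n²+1}⊗x}`. -/
theorem attr_eq_system
    (n : ℕ) (hn : 1 ≤ n) (A : Matrix (Fin n) (Fin n) ℝ≥0) (hA : IsCirculant A) :
    Attr A = {x : Fin n → ℝ≥0 |
      (fun i => lam A * mvec (mpow A (n ^ 2)) x i) = mvec (mpow A (n ^ 2 + 1)) x} := by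
  have : NeZero n := ⟨by omega⟩
  obtain ⟨a, rfl⟩ := hA
  obtain ⟨c, hc⟩ := Finite.exists_max a
  ext x
  refine ⟨fun ⟨s, hs⟩ => ?_, fun h => ⟨n ^ 2, h.symm⟩⟩
  change lam (circ a) • mvec (mpow (circ a) (n ^ 2)) x = mvec (mpow (circ a) (n ^ 2 + 1)) x
  change _ = lam (circ a) • mvec (mpow (circ a) s) x at hs
  rw [lam_circ a hc, mvec_mpow, mvec_mpow] at hs ⊢
  have hsq : n ≤ n ^ 2 := Nat.le_self_pow two_ne_zero n
  by_cases h0 : a c = 0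
  · rw [h0, zero_smul, Function.iterate_succ_apply']
    funext i
    have ha (k : Fin n) : a k = 0 := le_antisymm (h0 ▸ hc k) zero_le
    simp [mvec, circ, ha, Finset.sup_const Finset.univ_nonempty]
  have hsn : s ≤ n ^ 2 + n * s := le_add_left (Nat.le_mul_of_pos_left s hn)
  obtain ⟨r, hr⟩ := Nat.exists_eq_add_of_le' hsn
  rw [Function.iterate_succ_apply'] at hs
  have hlate : (mvec (circ a))^[n ^ 2 + n * s + 1] x =
      a c • (mvec (circ a))^[n ^ 2 + n * s] x := by
    rw [hr, Function.iterate_succ_apply', Function.iterate_add_apply,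
      iterate_mvec_eq_pow_smul hs, mvec_smul, hs, smul_comm]
  rw [add_right_comm, iterate_mvec_circ_add_mul a hc (by omega),
    iterate_mvec_circ_add_mul a hc (by omega), smul_comm] at hlate
  exact (smul_right_injective _ (pow_ne_zero (n * s) h0) hlate).symm
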